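/- Let d ≥ 1, let g be the Lie subalgebra of d×d complex matrices (with bracket [A,B] = AB − BA) spanned by E := Σ_{i=1}^{d-1} i·E_{i,i+1}, F := Σ_{i=1}^{d-1} (d−i)·E_{i+1,i}, H := Σ_{i=1}^{d} (d+1−2i)·E_{i,i}, and for 1 ≤ n ≤ d let V_n denote the g-submodule (under the adjoint action A·L := AL − LA) of the d×d matrices generated by E^{n−1}. Then the symmetric bilinear form β(L,M) := Tr(LM) restricted to V_n × V_n is non-degenerate: if L ∈ V_n satisfies Tr(LM) = 0 for all M ∈ V_n, then L = 0. -/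

import Mathlib

open Matrix

/-- `E = ∑_{i=1}^{d-1} i · E_{i,i+1}` (1-based indices), written entrywise with
0-based indices: the `(a, a+1)` entry is `a+1`. -/
noncomputable def matE (d : ℕ) : Matrix (Fin d) (Fin d) ℂ :=
  Matrix.of fun a b => if (b : ℕ) = (a : ℕ) + 1 then (((a : ℕ) + 1 : ℕ) : ℂ) else 0

/-- `F = ∑_{i=1}^{d-1} (d-i) · E_{i+1,i}`: the `(b+1, b)` entry is `d - (b+1)`. -/
noncomputable def matF (d : ℕ) : Matrix (Fin d) (Fin d) ℂ :=
  Matrix.of fun a b => if (a : ℕ) = (b : ℕ) + 1 then ((d : ℂ) - (((b : ℕ) + 1 : ℕ) : ℂ)) else 0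

/-- `H = ∑_{i=1}^{d} (d+1-2i) · E_{i,i}`: the `(a, a)` entry is `d + 1 - 2(a+1)`. -/
noncomputable def matH (d : ℕ) : Matrix (Fin d) (Fin d) ℂ :=
  Matrix.of fun a b => if a = b then ((d : ℂ) + 1 - 2 * (((a : ℕ) + 1 : ℕ) : ℂ)) else 0

/-- The image `g = span_ℂ{E, F, H} = ρ^{(d)}(sl₂(ℂ))`. -/
noncomputable def gSpan (d : ℕ) : Submodule ℂ (Matrix (Fin d) (Fin d) ℂ) :=
  Submodule.span ℂ {matE d, matF d, matH d}

/-- The `g`-submodule of the `d×d` matrices (for the adjoint action `A·L = AL - LA`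
of `g = gSpan d`) generated by a matrix `X`: the smallest `ℂ`-subspace containing
`X` that is closed under `L ↦ A*L - L*A` for every `A ∈ g`. -/
noncomputable def adSubmodule (d : ℕ) (X : Matrix (Fin d) (Fin d) ℂ) :
    Submodule ℂ (Matrix (Fin d) (Fin d) ℂ) :=
  sInf {W | X ∈ W ∧ ∀ A ∈ gSpan d, ∀ L ∈ W, A * L - L * A ∈ W}

theorem matE_apply {d : ℕ} (a b : Fin d) :
    matE d a b = if (b : ℕ) = (a : ℕ) + 1 then (((a : ℕ) + 1 : ℕ) : ℂ) else 0 := rfl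

theorem matF_apply {d : ℕ} (a b : Fin d) :
    matF d a b =
      if (a : ℕ) = (b : ℕ) + 1 then ((d : ℂ) - (((b : ℕ) + 1 : ℕ) : ℂ)) else 0 := rfl

theorem matH_eq_diagonal (d : ℕ) :
    matH d = diagonal fun a : Fin d => (d : ℂ) + 1 - 2 * (((a : ℕ) + 1 : ℕ) : ℂ) := rfl

theorem mul_matF_apply {d : ℕ} (X : Matrix (Fin d) (Fin d) ℂ) (a b c : Fin d)
    (hc : (c : ℕ) = b + 1) :
    (X * matF d) a b = X a c * ((d : ℂ) - (((b : ℕ) + 1 : ℕ) : ℂ)) := by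
  rw [Matrix.mul_apply, Finset.sum_eq_single c]
  · simp [matF_apply, hc]
  · intro x _ hx
    rw [matF_apply, if_neg, mul_zero]
    exact fun h => hx (Fin.ext (h.trans hc.symm))
  · simp

theorem matH_commutator_apply {d : ℕ} (X : Matrix (Fin d) (Fin d) ℂ) (a b : Fin d) :
    (matH d * X - X * matH d) a b = 2 * ((b : ℂ) - (a : ℂ)) * X a b := by
  rw [matH_eq_diagonal, Matrix.sub_apply, diagonal_mul, mul_diagonal]
  push_cast
  ring

theorem matH_commutator_matE (d : ℕ) :
    matH d * matE d - matE d * matH d = (2 : ℂ) • matE d := by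
  ext a b
  rw [matH_commutator_apply, Matrix.smul_apply, matE_apply, smul_eq_mul]
  split_ifs with h
  · rw [h]; push_cast; ring
  · ring

theorem matH_commutator_matF (d : ℕ) :
    matH d * matF d - matF d * matH d = (-2 : ℂ) • matF d := by
  ext a b
  rw [matH_commutator_apply, Matrix.smul_apply, matF_apply, smul_eq_mul]
  split_ifs with h
  · rw [h]; push_cast; ring
  · ring

theorem matE_mul_matF (d : ℕ) :
    matE d * matF d = diagonal fun a : Fin d => ((a : ℂ) + 1) * ((d : ℂ) - (a + 1)) := by
  ext a b
  by_cases hb : (b : ℕ) + 1 < d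
  · rw [mul_matF_apply _ a b ⟨b + 1, hb⟩ rfl, matE_apply, diagonal_apply]
    by_cases hab : a = b
    · subst hab; simp
    · have : (b : ℕ) ≠ a := fun h => hab (Fin.ext h.symm)
      simp [hab, this]
  · have hd : d = (b : ℕ) + 1 := by omega
    rw [Matrix.mul_apply, Finset.sum_eq_zero]
    · rw [diagonal_apply]
      split_ifs with hab
      · subst hab
        have : (d : ℂ) = (a : ℂ) + 1 := by exact_mod_cast hd
        rw [this]; ring
      · rfl
    · intro x _
      rw [matF_apply, if_neg, mul_zero]
      omega

theorem matF_mul_matE (d : ℕ) :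
    matF d * matE d = diagonal fun a : Fin d => (a : ℂ) * ((d : ℂ) - a) := by
  ext a b
  rw [Matrix.mul_apply, diagonal_apply]
  rcases Nat.eq_zero_or_pos (a : ℕ) with ha | ha
  · rw [Finset.sum_eq_zero]
    · simp [ha]
    · intro x _
      rw [matF_apply, if_neg, zero_mul]
      omega
  · obtain ⟨c, hc⟩ : ∃ c : Fin d, (a : ℕ) = c + 1 := ⟨⟨a - 1, by omega⟩, by simp; omega⟩
    rw [Finset.sum_eq_single c]
    · rw [matF_apply, matE_apply, if_pos hc, ← hc]
      by_cases hab : a = b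
      · subst hab; simp; ring
      · have : (b : ℕ) ≠ a := fun h => hab (Fin.ext h.symm)
        simp [hab, this]
    · intro x _ hx
      rw [matF_apply, if_neg, zero_mul]
      intro h
      exact hx (Fin.ext (by omega))
    · simp

theorem matE_commutator_matF (d : ℕ) :
    matE d * matF d - matF d * matE d = matH d := by
  rw [matE_mul_matF, matF_mul_matE, matH_eq_diagonal, diagonal_sub]
  congr 1
  ext a
  push_cast
  ring

/-- A matrix commuting with `F` is determined by its first column. -/
theorem eq_zero_of_commute_matF {d : ℕ} {X : Matrix (Fin d) (Fin d) ℂ}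
    (hX : matF d * X = X * matF d) (h0 : ∀ a b : Fin d, (b : ℕ) = 0 → X a b = 0) : X = 0 := by
  have key : ∀ m : ℕ, ∀ a b : Fin d, (b : ℕ) = m → X a b = 0 := by
    intro m
    induction m with
    | zero => exact h0
    | succ m ih =>
      intro a b hb
      have hm : m < d := by omega
      have h1 := congrFun (congrFun hX a) ⟨m, hm⟩
      rw [mul_matF_apply X a ⟨m, hm⟩ b hb, Matrix.mul_apply, Finset.sum_eq_zero] at h1
      · refine (mul_eq_zero.mp h1.symm).resolve_right (sub_ne_zero.mpr ?_)
        have : d ≠ m + 1 := by omega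
        exact_mod_cast this
      · intro x _
        rw [ih x _ rfl, mul_zero]
  ext a b
  exact key b a b rfl

theorem commutator_pow {R : Type*} [Ring R] [Algebra ℂ R] {H X : R} {c : ℂ}
    (h : H * X - X * H = c • X) (k : ℕ) :
    H * X ^ k - X ^ k * H = ((k : ℂ) * c) • X ^ k := by
  induction k with
  | zero => simp
  | succ k ih =>
    have : H * X ^ (k + 1) - X ^ (k + 1) * H
        = (H * X ^ k - X ^ k * H) * X + X ^ k * (H * X - X * H) := by
      rw [pow_succ]; noncomm_ring
    rw [this, ih, h, smul_mul_assoc, mul_smul_comm, ← pow_succ, ← add_smul]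
    push_cast
    ring_nf

theorem apply_eq_zero_of_matH_commutator {d k : ℕ} {X : Matrix (Fin d) (Fin d) ℂ}
    (hX : matH d * X - X * matH d = (-2 * (k : ℂ)) • X) {a b : Fin d}
    (hab : (a : ℕ) ≠ b + k) : X a b = 0 := by
  have h1 := congrFun (congrFun hX a) b
  rw [matH_commutator_apply, Matrix.smul_apply, smul_eq_mul] at h1
  have h2 : ((b : ℂ) + k - a) * X a b = 0 := by linear_combination h1 / 2
  refine (mul_eq_zero.mp h2).resolve_left (sub_ne_zero.mpr ?_)
  exact_mod_cast hab.symm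

theorem mem_adSubmodule_self (d : ℕ) (X : Matrix (Fin d) (Fin d) ℂ) : X ∈ adSubmodule d X :=
  Submodule.mem_sInf.mpr fun _ hW => hW.1

theorem commutator_mem_adSubmodule {d : ℕ} {X A L : Matrix (Fin d) (Fin d) ℂ}
    (hA : A ∈ gSpan d) (hL : L ∈ adSubmodule d X) : A * L - L * A ∈ adSubmodule d X :=
  Submodule.mem_sInf.mpr fun W hW => hW.2 A hA L (Submodule.mem_sInf.mp hL W hW)

theorem adSubmodule_le {d : ℕ} {X : Matrix (Fin d) (Fin d) ℂ}
    {W : Submodule ℂ (Matrix (Fin d) (Fin d) ℂ)} (hX : X ∈ W)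
    (hW : ∀ A ∈ gSpan d, ∀ L ∈ W, A * L - L * A ∈ W) : adSubmodule d X ≤ W :=
  sInf_le ⟨hX, hW⟩

theorem matE_mem_gSpan (d : ℕ) : matE d ∈ gSpan d := Submodule.subset_span (by simp)

theorem matF_mem_gSpan (d : ℕ) : matF d ∈ gSpan d := Submodule.subset_span (by simp)

theorem matH_mem_gSpan (d : ℕ) : matH d ∈ gSpan d := Submodule.subset_span (by simp)

section LieStructure

attribute [local instance] LieRing.ofAssociativeRing

theorem isSl2Triple_mat {d : ℕ} (hH : matH d ≠ 0) : IsSl2Triple (matH d) (matE d) (matF d) where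
  h_ne_zero := hH
  lie_e_f := matE_commutator_matF d
  lie_h_e_nsmul := by
    rw [Ring.lie_def, matH_commutator_matE, two_smul, two_nsmul]
  lie_h_f_nsmul := by
    rw [Ring.lie_def, matH_commutator_matF, neg_smul, two_smul, two_nsmul]

/-- The lowest weight vector `(ad F)^{2k} E^k` is a nonzero multiple of `F^k`. -/
theorem matF_pow_mem_adSubmodule {d k : ℕ} (hk : k < d) (hE : matE d ^ k ≠ 0) :
    matF d ^ k ∈ adSubmodule d (matE d ^ k) := by
  rcases Nat.eq_zero_or_pos k with rfl | hk0
  · rw [pow_zero, pow_zero]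
    exact mem_adSubmodule_self d 1
  have hH : matH d ≠ 0 := by
    intro h0
    have h1 := matH_commutator_apply (matE d) ⟨0, by omega⟩ ⟨1, by omega⟩
    rw [h0] at h1
    simp [matE_apply] at h1
  have t := isSl2Triple_mat hH
  have P : t.HasPrimitiveVectorWith (matE d ^ k) (((2 * k : ℕ) : ℂ)) :=
    { ne_zero := hE
      lie_h := by
        rw [Ring.lie_def, commutator_pow (matH_commutator_matE d)]
        push_cast
        ring_nf
      lie_e := by
        rw [Ring.lie_def, ← pow_succ, ← pow_succ', sub_self] }
  set φ := LieModule.toEnd ℂ (Matrix (Fin d) (Fin d) ℂ) (Matrix (Fin d) (Fin d) ℂ) (matF d)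
    with hφ
  set u := (φ ^ (2 * k)) (matE d ^ k) with hu
  have hmem : ∀ m : ℕ, (φ ^ m) (matE d ^ k) ∈ adSubmodule d (matE d ^ k) := by
    intro m
    induction m with
    | zero => exact mem_adSubmodule_self _ _
    | succ m ih =>
      rw [pow_succ', Module.End.mul_apply]
      exact commutator_mem_adSubmodule (matF_mem_gSpan d) ih
  have hu0 : u ≠ 0 := P.pow_toEnd_f_ne_zero_of_eq_nat rfl le_rfl
  have hFu : matF d * u = u * matF d := by
    have h1 := P.pow_toEnd_f_eq_zero_of_eq_nat rfl
    rw [pow_succ', Module.End.mul_apply] at h1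
    exact sub_eq_zero.mp h1
  have hHu : matH d * u - u * matH d = (-2 * (k : ℂ)) • u := by
    have h1 := P.lie_h_pow_toEnd_f (2 * k)
    rw [Ring.lie_def] at h1
    refine h1.trans ?_
    congr 1
    push_cast
    ring
  have hHF : matH d * matF d ^ k - matF d ^ k * matH d = (-2 * (k : ℂ)) • matF d ^ k := by
    rw [commutator_pow (matH_commutator_matF d), mul_comm]
  set i : Fin d := ⟨k, hk⟩
  set j : Fin d := ⟨0, by omega⟩
  have hlin : (matF d ^ k) i j • u - u i j • matF d ^ k = 0 := by
    apply eq_zero_of_commute_matF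
    · simp only [mul_sub, sub_mul, mul_smul_comm, smul_mul_assoc, hFu, ← pow_succ, ← pow_succ']
    · intro a b hb
      obtain rfl : b = j := Fin.ext hb
      by_cases ha : a = i
      · subst ha
        simp [mul_comm]
      · have ha' : (a : ℕ) ≠ (j : ℕ) + k := fun h => ha (Fin.ext (by simpa [j] using h))
        simp [apply_eq_zero_of_matH_commutator hHu ha', apply_eq_zero_of_matH_commutator hHF ha']
  have hc : u i j ≠ 0 := by
    intro hc
    apply hu0
    apply eq_zero_of_commute_matF hFu
    intro a b hb
    obtain rfl : b = j := Fin.ext hb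
    by_cases ha : a = i
    · rw [ha, hc]
    · exact apply_eq_zero_of_matH_commutator hHu
        fun h => ha (Fin.ext (by simpa [j] using h))
  rw [← Submodule.smul_mem_iff _ hc, ← sub_eq_zero.mp hlin]
  exact Submodule.smul_mem _ _ (hmem _)

end LieStructure

/-- The diagonal matrix of binomial coefficients, conjugating the transpose of `E` to `F`. -/
noncomputable def binomDiag (d : ℕ) : Matrix (Fin d) (Fin d) ℂ :=
  diagonal fun a => ((d - 1).choose a : ℂ)

noncomputable def binomDiagInv (d : ℕ) : Matrix (Fin d) (Fin d) ℂ :=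
  diagonal fun a => ((d - 1).choose a : ℂ)⁻¹

theorem choose_pred_pos {d : ℕ} (a : Fin d) : 0 < (d - 1).choose a :=
  Nat.choose_pos (by omega)

theorem binomDiagInv_mul_binomDiag (d : ℕ) : binomDiagInv d * binomDiag d = 1 := by
  rw [binomDiagInv, binomDiag, diagonal_mul_diagonal, ← diagonal_one]
  congr 1
  ext a
  exact inv_mul_cancel₀ (by exact_mod_cast (choose_pred_pos a).ne')

theorem binomDiag_mul_binomDiagInv (d : ℕ) : binomDiag d * binomDiagInv d = 1 :=
  mul_eq_one_comm.mp (binomDiagInv_mul_binomDiag d)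

/-- The adjoint with respect to the Hermitian form weighted by binomial coefficients. -/
noncomputable def weightedAdjoint {d : ℕ} (X : Matrix (Fin d) (Fin d) ℂ) :
    Matrix (Fin d) (Fin d) ℂ :=
  binomDiag d * Xᴴ * binomDiagInv d

theorem weightedAdjoint_apply {d : ℕ} (X : Matrix (Fin d) (Fin d) ℂ) (a b : Fin d) :
    weightedAdjoint X a b =
      ((d - 1).choose a : ℂ) * star (X b a) * ((d - 1).choose b : ℂ)⁻¹ := by
  rw [weightedAdjoint, binomDiag, binomDiagInv, mul_diagonal, diagonal_mul, conjTranspose_apply]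

theorem weightedAdjoint_zero (d : ℕ) :
    weightedAdjoint (0 : Matrix (Fin d) (Fin d) ℂ) = 0 := by
  simp [weightedAdjoint]

theorem weightedAdjoint_add {d : ℕ} (X Y : Matrix (Fin d) (Fin d) ℂ) :
    weightedAdjoint (X + Y) = weightedAdjoint X + weightedAdjoint Y := by
  simp [weightedAdjoint, mul_add, add_mul]

theorem weightedAdjoint_sub {d : ℕ} (X Y : Matrix (Fin d) (Fin d) ℂ) :
    weightedAdjoint (X - Y) = weightedAdjoint X - weightedAdjoint Y := by
  simp [weightedAdjoint, mul_sub, sub_mul]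

theorem weightedAdjoint_smul {d : ℕ} (c : ℂ) (X : Matrix (Fin d) (Fin d) ℂ) :
    weightedAdjoint (c • X) = star c • weightedAdjoint X := by
  simp [weightedAdjoint]

theorem weightedAdjoint_mul {d : ℕ} (X Y : Matrix (Fin d) (Fin d) ℂ) :
    weightedAdjoint (X * Y) = weightedAdjoint Y * weightedAdjoint X := by
  calc weightedAdjoint (X * Y) = binomDiag d * Yᴴ * 1 * Xᴴ * binomDiagInv d := by
        simp [weightedAdjoint, mul_assoc]
    _ = weightedAdjoint Y * weightedAdjoint X := by
        rw [← binomDiagInv_mul_binomDiag d]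
        simp only [weightedAdjoint, mul_assoc]

theorem weightedAdjoint_one (d : ℕ) :
    weightedAdjoint (1 : Matrix (Fin d) (Fin d) ℂ) = 1 := by
  rw [weightedAdjoint, conjTranspose_one, mul_one, binomDiag_mul_binomDiagInv]

theorem weightedAdjoint_pow {d : ℕ} (X : Matrix (Fin d) (Fin d) ℂ) (k : ℕ) :
    weightedAdjoint (X ^ k) = weightedAdjoint X ^ k := by
  induction k with
  | zero => exact weightedAdjoint_one d
  | succ k ih => rw [pow_succ, weightedAdjoint_mul, ih, pow_succ']

theorem choose_pred_succ_mul {d m : ℕ} (hm : m + 1 < d) :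
    ((d - 1).choose (m + 1) : ℂ) * ((m : ℂ) + 1) = ((d - 1).choose m : ℂ) * ((d : ℂ) - (m + 1)) := by
  have h := Nat.choose_succ_right_eq (d - 1) m
  have h2 : ((d - 1 - m : ℕ) : ℂ) = (d : ℂ) - (m + 1) := by
    rw [Nat.sub_sub, Nat.cast_sub (by omega)]
    push_cast
    ring
  rw [← h2]
  exact_mod_cast h

theorem weightedAdjoint_matE (d : ℕ) : weightedAdjoint (matE d) = matF d := by
  ext a b
  rw [weightedAdjoint_apply, matE_apply, matF_apply]
  split_ifs with h
  · have hb : ((d - 1).choose b : ℂ) ≠ 0 := by exact_mod_cast (choose_pred_pos b).ne'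
    have := choose_pred_succ_mul (d := d) (m := b) (by omega)
    rw [← div_eq_mul_inv, div_eq_iff hb, h]
    simp only [star_natCast]
    push_cast
    linear_combination this
  · simp

theorem weightedAdjoint_matF (d : ℕ) : weightedAdjoint (matF d) = matE d := by
  ext a b
  rw [weightedAdjoint_apply, matE_apply, matF_apply]
  split_ifs with h
  · have hb : ((d - 1).choose b : ℂ) ≠ 0 := by exact_mod_cast (choose_pred_pos b).ne'
    have := choose_pred_succ_mul (d := d) (m := a) (by omega)
    rw [← div_eq_mul_inv, div_eq_iff hb, h]
    simp only [star_natCast, star_sub]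
    push_cast
    linear_combination -this
  · simp

theorem weightedAdjoint_matH (d : ℕ) : weightedAdjoint (matH d) = matH d := by
  rw [← matE_commutator_matF, weightedAdjoint_sub, weightedAdjoint_mul, weightedAdjoint_mul,
    weightedAdjoint_matE, weightedAdjoint_matF]

/-- The preimage of a subspace under the conjugate-linear map `weightedAdjoint`. -/
noncomputable def weightedAdjointComap {d : ℕ} (V : Submodule ℂ (Matrix (Fin d) (Fin d) ℂ)) :
    Submodule ℂ (Matrix (Fin d) (Fin d) ℂ) where
  carrier := {X | weightedAdjoint X ∈ V}
  add_mem' hX hY := by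
    simpa only [Set.mem_ofPred_eq, weightedAdjoint_add] using V.add_mem hX hY
  zero_mem' := by
    simp only [Set.mem_ofPred_eq, weightedAdjoint_zero, V.zero_mem]
  smul_mem' c X hX := by
    simpa only [Set.mem_ofPred_eq, weightedAdjoint_smul] using V.smul_mem (star c) hX

theorem mem_weightedAdjointComap {d : ℕ} {V : Submodule ℂ (Matrix (Fin d) (Fin d) ℂ)}
    {X : Matrix (Fin d) (Fin d) ℂ} : X ∈ weightedAdjointComap V ↔ weightedAdjoint X ∈ V :=
  Iff.rfl

theorem weightedAdjoint_mem_gSpan {d : ℕ} {A : Matrix (Fin d) (Fin d) ℂ} (hA : A ∈ gSpan d) :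
    weightedAdjoint A ∈ gSpan d := by
  have hle : gSpan d ≤ weightedAdjointComap (gSpan d) := by
    refine Submodule.span_le.mpr ?_
    rintro X (rfl | rfl | rfl)
    · rw [SetLike.mem_coe, mem_weightedAdjointComap, weightedAdjoint_matE]
      exact matF_mem_gSpan d
    · rw [SetLike.mem_coe, mem_weightedAdjointComap, weightedAdjoint_matF]
      exact matE_mem_gSpan d
    · rw [SetLike.mem_coe, mem_weightedAdjointComap, weightedAdjoint_matH]
      exact matH_mem_gSpan d
  exact hle hA

theorem weightedAdjoint_mem_adSubmodule {d k : ℕ} (hk : k < d) {L : Matrix (Fin d) (Fin d) ℂ}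
    (hL : L ∈ adSubmodule d (matE d ^ k)) : weightedAdjoint L ∈ adSubmodule d (matE d ^ k) := by
  have hle : adSubmodule d (matE d ^ k) ≤
      weightedAdjointComap (adSubmodule d (matE d ^ k)) := by
    apply adSubmodule_le
    · rw [mem_weightedAdjointComap]
      by_cases hE : matE d ^ k = 0
      · rw [hE, weightedAdjoint_zero]
        exact Submodule.zero_mem _
      · rw [weightedAdjoint_pow, weightedAdjoint_matE]
        exact matF_pow_mem_adSubmodule hk hE
    · intro A hA X hX
      rw [mem_weightedAdjointComap] at hX ⊢
      rw [weightedAdjoint_sub, weightedAdjoint_mul, weightedAdjoint_mul, ← neg_sub]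
      exact Submodule.neg_mem _ (commutator_mem_adSubmodule (weightedAdjoint_mem_gSpan hA) hX)
  exact hle hL

theorem eq_zero_of_trace_mul_weightedAdjoint {d : ℕ} {L : Matrix (Fin d) (Fin d) ℂ}
    (h : Matrix.trace (L * weightedAdjoint L) = 0) : L = 0 := by
  have hterm : ∀ a b : Fin d, L a b * weightedAdjoint L b a =
      ((Complex.normSq (L a b) * ((d - 1).choose b : ℝ) * ((d - 1).choose a : ℝ)⁻¹ : ℝ) : ℂ) := by
    intro a b
    rw [weightedAdjoint_apply]
    push_cast
    rw [← Complex.mul_conj]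
    simp only [Complex.star_def]
    ring
  simp only [Matrix.trace, Matrix.diag_apply, Matrix.mul_apply, hterm] at h
  norm_cast at h
  have hnonneg : ∀ a b : Fin d, 0 ≤
      Complex.normSq (L a b) * ((d - 1).choose b : ℝ) * ((d - 1).choose a : ℝ)⁻¹ := fun a b =>
    mul_nonneg (mul_nonneg (Complex.normSq_nonneg _) (Nat.cast_nonneg _))
      (inv_nonneg.mpr (Nat.cast_nonneg _))
  ext a b
  have ha := (Finset.sum_eq_zero_iff_of_nonneg
    fun a _ => Finset.sum_nonneg fun b _ => hnonneg a b).mp h a (Finset.mem_univ a)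
  have hab := (Finset.sum_eq_zero_iff_of_nonneg fun b _ => hnonneg a b).mp ha b (Finset.mem_univ b)
  simpa [(choose_pred_pos a).ne', (choose_pred_pos b).ne'] using hab

/-- For `1 ≤ n ≤ d`, the trace form `β(L,M) = Tr(LM)` restricted to `V_n × V_n` is
non-degenerate: if `L ∈ V_n` satisfies `Tr(LM) = 0` for all `M ∈ V_n`, then `L = 0`.
Here `V_n` is the `g`-submodule of the `d×d` matrices generated by `E^{n-1}`. -/
theorem stmt13 (d : ℕ) (hd : 1 ≤ d) (n : ℕ) (hn1 : 1 ≤ n) (hn2 : n ≤ d)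
    (L : Matrix (Fin d) (Fin d) ℂ) (hL : L ∈ adSubmodule d ((matE d) ^ (n - 1)))
    (h : ∀ M ∈ adSubmodule d ((matE d) ^ (n - 1)), Matrix.trace (L * M) = 0) :
    L = 0 := by
  exact eq_zero_of_trace_mul_weightedAdjoint
    (h _ (weightedAdjoint_mem_adSubmodule (by omega) hL))
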